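/- Let m be a positive integer and let K ∈ O(4m,ℂ) be a matrix whose conjugation action stabilizes the group SO(2m,ℍ), i.e., for every M ∈ SO(4m,ℂ) satisfying M·J_{4m} = J_{4m}·conj(M), the matrix K·M·K⁻¹ also satisfies (K·M·K⁻¹)·J_{4m} = J_{4m}·conj(K·M·K⁻¹). Then det K = 1. In particular, SO(2m,ℍ) and its conjugate by any matrix of O(4m,ℂ) of determinant −1 are not conjugated inside SO(4m,ℂ). -/

import Mathlib

open Matrix

noncomputable section

/-- The standard symplectic matrix `J_{2n} = [[0, Iₙ],[−Iₙ, 0]]`. -/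
def Jmat (n : ℕ) : Matrix (Fin n ⊕ Fin n) (Fin n ⊕ Fin n) ℂ :=
  Matrix.fromBlocks 0 1 (-1) 0

/-- `M ∈ O(2n,ℂ)`, i.e. `ᵀM M = I_{2n}`. -/
def IsOrthoC {n : ℕ} (M : Matrix (Fin n ⊕ Fin n) (Fin n ⊕ Fin n) ℂ) : Prop :=
  Mᵀ * M = 1

/-- A complex linear endomorphism commuting with a quaternionic structure has nonnegative
real determinant. -/
theorem LinearMap.det_nonneg_of_commute_quaternionic (d : ℕ) :
    ∀ (V : Type) [AddCommGroup V] [Module ℂ V] [FiniteDimensional ℂ V]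
      (f : V →ₗ[ℂ] V) (j : V →ₛₗ[starRingEnd ℂ] V), Module.finrank ℂ V = d →
      (∀ v, j (j v) = -v) → (∀ v, j (f v) = f (j v)) →
      ∃ r : ℝ, 0 ≤ r ∧ LinearMap.det f = (r : ℂ) := by
  induction d using Nat.strong_induction_on with
  | _ d ih =>
  intro V _ _ _ f j hd hj hjf
  rcases subsingleton_or_nontrivial V with hV | hV
  · exact ⟨1, zero_le_one, by simp [LinearMap.det_eq_one_of_subsingleton]⟩
  obtain ⟨l, hl⟩ := Module.End.exists_eigenvalue f
  obtain ⟨v, hv⟩ := hl.exists_hasEigenvector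
  have hv0 : v ≠ 0 := hv.2
  have hfv : f v = l • v := hv.apply_eq_smul
  have hfjv : f (j v) = (starRingEnd ℂ l) • j v := by
    rw [← hjf, hfv, LinearMap.map_smulₛₗ]
  have hind : LinearIndependent ℂ ![v, j v] := by
    rw [LinearIndependent.pair_iff' hv0]
    intro a ha
    have h1 : j (j v) = (starRingEnd ℂ a * a) • v := by
      rw [← ha, LinearMap.map_smulₛₗ, ← ha, smul_smul]
    rw [hj, ← neg_one_smul ℂ v] at h1
    have h2 := smul_left_injective ℂ hv0 h1
    rw [mul_comm, Complex.mul_conj] at h2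
    have h3 : (-1 : ℝ) = Complex.normSq a := by exact_mod_cast h2
    linarith [Complex.normSq_nonneg a]
  let W : Submodule ℂ V := Submodule.span ℂ (Set.range ![v, j v])
  let b : Module.Basis (Fin 2) ℂ W := Module.Basis.span hind
  have hb : ∀ i, (b i : V) = ![v, j v] i := fun i =>
    congrArg Subtype.val (Module.Basis.span_apply hind i)
  have hvW : v ∈ W := Submodule.subset_span ⟨0, rfl⟩
  have hjvW : j v ∈ W := Submodule.subset_span ⟨1, rfl⟩
  have hWf : W ≤ W.comap f := by
    refine Submodule.span_le.2 ?_
    rintro _ ⟨i, rfl⟩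
    fin_cases i
    · simpa [hfv] using W.smul_mem _ hvW
    · simpa [hfjv] using W.smul_mem _ hjvW
  have hWj : W ≤ W.comap j := by
    refine Submodule.span_le.2 ?_
    rintro _ ⟨i, rfl⟩
    fin_cases i
    · simpa using hjvW
    · simpa [hj] using hvW
  have hdW : LinearMap.det (f.restrict hWf) = ((Complex.normSq l : ℝ) : ℂ) := by
    have h0 : f.restrict hWf (b 0) = l • b 0 := by
      ext; simp [hb, hfv]
    have h1 : f.restrict hWf (b 1) = (starRingEnd ℂ l) • b 1 := by
      ext; simp [hb, hfjv]
    rw [← LinearMap.det_toMatrix b, Matrix.det_fin_two]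
    simp [LinearMap.toMatrix_apply, h0, h1, Complex.mul_conj]
  have hlt : Module.finrank ℂ (V ⧸ W) < d := by
    have h1 := Submodule.finrank_quotient_add_finrank W
    have h2 : Module.finrank ℂ W = 2 := by simpa using Module.finrank_eq_card_basis b
    omega
  obtain ⟨r, hr, hdet⟩ := ih _ hlt (V ⧸ W) (W.mapQ W f hWf) (W.mapQ W j hWj) rfl
    (by
      intro x
      obtain ⟨x, rfl⟩ := W.mkQ_surjective x
      simp [hj])
    (by
      intro x
      obtain ⟨x, rfl⟩ := W.mkQ_surjective x
      simp [hjf])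
  refine ⟨Complex.normSq l * r, mul_nonneg (Complex.normSq_nonneg l) hr, ?_⟩
  rw [LinearMap.det_eq_det_mul_det W f hWf, hdW, hdet]
  push_cast
  rfl

theorem Jmat_mul_self (n : ℕ) : Jmat n * Jmat n = -1 := by
  rw [← fromBlocks_one, fromBlocks_neg]
  simp [Jmat, fromBlocks_multiply]

theorem Jmat_transpose (n : ℕ) : (Jmat n)ᵀ = -Jmat n := by
  simp [Jmat, fromBlocks_transpose, fromBlocks_neg]

theorem Jmat_map_conj (n : ℕ) : (Jmat n).map (starRingEnd ℂ) = Jmat n := by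
  simp [Jmat, fromBlocks_map, Matrix.map_neg, Matrix.map_zero, Matrix.map_one]

/-- The antilinear quaternionic structure `v ↦ J * conj v`. -/
def quaternionicStructure (n : ℕ) :
    (Fin n ⊕ Fin n → ℂ) →ₛₗ[starRingEnd ℂ] (Fin n ⊕ Fin n → ℂ) where
  toFun v := Jmat n *ᵥ star v
  map_add' v w := by simp [mulVec_add]
  map_smul' a v := by simp [mulVec_smul]

theorem det_nonneg_of_mul_Jmat {n : ℕ} {X : Matrix (Fin n ⊕ Fin n) (Fin n ⊕ Fin n) ℂ}
    (hX : X * Jmat n = Jmat n * X.map (starRingEnd ℂ)) :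
    ∃ r : ℝ, 0 ≤ r ∧ X.det = (r : ℂ) := by
  have hstar (Y : Matrix (Fin n ⊕ Fin n) (Fin n ⊕ Fin n) ℂ) (v : Fin n ⊕ Fin n → ℂ) :
      star (Y *ᵥ v) = Y.map (starRingEnd ℂ) *ᵥ star v := by
    ext i
    simp [mulVec, dotProduct, -Fintype.sum_sum_type]
  rw [← LinearMap.det_toLin']
  refine LinearMap.det_nonneg_of_commute_quaternionic _ _ (toLin' X) (quaternionicStructure n)
    rfl (fun v => ?_) (fun v => ?_)
  · simp [quaternionicStructure, hstar, Jmat_map_conj, Jmat_mul_self, neg_mulVec]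
  · simp [quaternionicStructure, hstar, hX]

theorem IsOrthoC.det_eq_one {n : ℕ} {X : Matrix (Fin n ⊕ Fin n) (Fin n ⊕ Fin n) ℂ}
    (hX : IsOrthoC X) {r : ℝ} (hr : 0 ≤ r) (hdet : X.det = (r : ℂ)) : X.det = 1 := by
  have h : X.det * X.det = 1 := by
    have := congrArg det (show Xᵀ * X = 1 from hX)
    simpa using this
  rw [hdet] at h ⊢
  have h' : r * r = 1 := by exact_mod_cast h
  have : r = 1 := by nlinarith
  simp [this]

/-- A matrix commuting with all real orthogonal matrices is scalar. -/
theorem exists_eq_smul_one_of_commute_orthogonal {n : ℕ} {P : Matrix (Fin n) (Fin n) ℂ}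
    (h : ∀ A : Matrix (Fin n) (Fin n) ℂ, Aᵀ * A = 1 → A.map (starRingEnd ℂ) = A →
      P * A = A * P) : ∃ p : ℂ, P = p • (1 : Matrix (Fin n) (Fin n) ℂ) := by
  have hdiag (i : Fin n) : Commute (single i i (1 : ℂ)) P := by
    have h1 := h (1 - (2 : ℂ) • single i i 1) (by
      have hs : single i i (1 : ℂ) * single i i 1 = single i i 1 := by simp
      rw [transpose_sub, transpose_smul, transpose_one, transpose_single, sub_mul, mul_sub,
        mul_sub, smul_mul_smul_comm, hs, one_mul, mul_one, one_mul]
      module) (by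
      ext a b
      simp only [map_apply, Matrix.sub_apply, Matrix.smul_apply, one_apply, single_apply]
      split_ifs <;> simp [map_ofNat (starRingEnd ℂ)])
    rw [mul_sub, sub_mul, mul_one, one_mul, mul_smul_comm, smul_mul_assoc] at h1
    have h2 := smul_right_injective _ (two_ne_zero (α := ℂ)) (sub_right_injective h1)
    exact h2.symm
  have hoff : Pairwise fun i j => Commute (single i j (1 : ℂ)) P := by
    intro i j _
    have h1 : Commute (swap ℂ i j) P :=
      (h (swap ℂ i j) (by simp [swap_mul_self]) (map_swap _ i j)).symm
    have h2 : single i j (1 : ℂ) = single i i 1 * swap ℂ i j := by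
      ext a b
      by_cases ha : a = i
      · subst ha
        simp [swap, PEquiv.toMatrix_apply, single_apply]
      · rw [single_mul_apply_of_ne _ _ _ _ _ ha, single_apply_of_row_ne (Ne.symm ha)]
    rw [h2]
    exact (hdiag i).mul_left h1
  obtain ⟨p, hp⟩ := mem_range_scalar_of_commute_single hoff
  exact ⟨p, by rw [← hp, scalar_apply, smul_one_eq_diagonal]⟩

/-- In even dimension there is a real orthogonal complex structure. -/
theorem exists_real_complex_structure (m : ℕ) : ∃ S : Matrix (Fin (2 * m)) (Fin (2 * m)) ℂ,
    S * S = -1 ∧ Sᵀ = -S ∧ S.map (starRingEnd ℂ) = S := by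
  let e : Fin (2 * m) ≃ Fin m ⊕ Fin m := (finCongr (two_mul m)).trans finSumFinEquiv.symm
  refine ⟨(Jmat m).submatrix e e, ?_, ?_, ?_⟩
  · rw [submatrix_mul_equiv, Jmat_mul_self, submatrix_neg]
    simp
  · rw [transpose_submatrix, Jmat_transpose, submatrix_neg]
    rfl
  · rw [← submatrix_map, Jmat_map_conj]

/-- The commutant of the quaternionic orthogonal group consists of scalars. -/
theorem exists_eq_smul_one_of_commute_quaternionic_orthogonal {m : ℕ}
    {T : Matrix (Fin (2 * m) ⊕ Fin (2 * m)) (Fin (2 * m) ⊕ Fin (2 * m)) ℂ}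
    (h : ∀ M : Matrix (Fin (2 * m) ⊕ Fin (2 * m)) (Fin (2 * m) ⊕ Fin (2 * m)) ℂ,
      IsOrthoC M → M * Jmat (2 * m) = Jmat (2 * m) * M.map (starRingEnd ℂ) → T * M = M * T) :
    ∃ p : ℂ, T = p • (1 : Matrix (Fin (2 * m) ⊕ Fin (2 * m)) (Fin (2 * m) ⊕ Fin (2 * m)) ℂ) := by
  obtain ⟨P, Q, R, U, rfl⟩ : ∃ P Q R U, T = fromBlocks P Q R U :=
    ⟨_, _, _, _, (fromBlocks_toBlocks T).symm⟩
  have hblk (A : Matrix (Fin (2 * m)) (Fin (2 * m)) ℂ) (hA : Aᵀ * A = 1)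
      (hA' : A.map (starRingEnd ℂ) = A) :
      P * A = A * P ∧ Q * A = A * Q ∧ R * A = A * R ∧ U * A = A * U := by
    have := h (fromBlocks A 0 0 A)
      (by simp [IsOrthoC, fromBlocks_transpose, fromBlocks_multiply, hA])
      (by simp [Jmat, fromBlocks_map, fromBlocks_multiply, hA', Matrix.map_zero])
    simpa [fromBlocks_multiply, fromBlocks_inj] using this
  obtain ⟨p, rfl⟩ := exists_eq_smul_one_of_commute_orthogonal fun A h1 h2 => (hblk A h1 h2).1
  obtain ⟨q, rfl⟩ := exists_eq_smul_one_of_commute_orthogonal fun A h1 h2 => (hblk A h1 h2).2.1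
  obtain ⟨r, rfl⟩ := exists_eq_smul_one_of_commute_orthogonal fun A h1 h2 => (hblk A h1 h2).2.2.1
  obtain ⟨u, rfl⟩ := exists_eq_smul_one_of_commute_orthogonal fun A h1 h2 => (hblk A h1 h2).2.2.2
  have hJ := h (Jmat (2 * m))
    (by simp [IsOrthoC, Jmat_transpose, Jmat_mul_self]) (by rw [Jmat_map_conj])
  simp only [Jmat, fromBlocks_multiply, fromBlocks_inj, mul_zero, zero_mul, mul_one, one_mul,
    zero_add, add_zero, mul_neg, neg_mul] at hJ
  obtain ⟨hqr, hpu, -, -⟩ := hJ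
  obtain ⟨S, hS, hSt, hSc⟩ := exists_real_complex_structure m
  have hM := h (fromBlocks ((5 / 3 : ℂ) • 1) ((4 / 3 * Complex.I) • S)
      ((4 / 3 * Complex.I) • S) ((5 / 3 : ℂ) • 1))
    (by
      have hI : (4 / 3 * Complex.I) * (4 / 3 * Complex.I) = -16 / 9 := by
        linear_combination (16 / 9 : ℂ) * Complex.I_mul_I
      simp only [IsOrthoC, fromBlocks_transpose, fromBlocks_multiply, transpose_smul,
        transpose_one, hSt, smul_mul_smul_comm, mul_one, one_mul, neg_mul,
        hS, hI, neg_neg]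
      rw [← fromBlocks_one, fromBlocks_inj]
      refine ⟨?_, ?_, ?_, ?_⟩ <;> module)
    (by
      have hSc' : ((4 / 3 * Complex.I) • S).map (starRingEnd ℂ) = -((4 / 3 * Complex.I) • S) := by
        ext a b
        have := congrFun (congrFun hSc a) b
        simp only [map_apply] at this
        simp [this, map_ofNat (starRingEnd ℂ)]
      have h1 : ((5 / 3 : ℂ) • (1 : Matrix (Fin (2 * m)) (Fin (2 * m)) ℂ)).map (starRingEnd ℂ)
          = (5 / 3 : ℂ) • 1 := by
        ext a b
        by_cases hab : a = b <;> simp [one_apply, hab, map_ofNat (starRingEnd ℂ)]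
      simp only [Jmat, fromBlocks_map, fromBlocks_multiply, hSc', h1]
      simp)
  simp only [fromBlocks_multiply, fromBlocks_inj] at hM
  have hq : q • (1 : Matrix (Fin (2 * m)) (Fin (2 * m)) ℂ) = 0 := by
    have h1 := hM.1
    rw [← hqr] at h1
    have h2 := congrArg (· * S) h1
    simp only [smul_mul_assoc, mul_smul_comm, one_mul, mul_one, mul_neg, add_mul, hS,
      smul_neg, neg_mul, neg_neg] at h2
    have h3 : (8 / 3 * Complex.I) • q • (1 : Matrix (Fin (2 * m)) (Fin (2 * m)) ℂ) = 0 := by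
      rw [← sub_eq_zero] at h2
      rw [← neg_eq_zero, ← h2]
      module
    exact (smul_eq_zero.1 h3).resolve_left (by simp)
  refine ⟨p, ?_⟩
  rw [← hqr, ← hpu, hq, neg_zero, ← fromBlocks_one, fromBlocks_smul, smul_zero]

theorem stmt13 {m : ℕ} (hm : 0 < m)
    (K : Matrix (Fin (2 * m) ⊕ Fin (2 * m)) (Fin (2 * m) ⊕ Fin (2 * m)) ℂ)
    (hK : IsOrthoC K)
    (hstab : ∀ M : Matrix (Fin (2 * m) ⊕ Fin (2 * m)) (Fin (2 * m) ⊕ Fin (2 * m)) ℂ,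
      IsOrthoC M → M.det = 1 → M * Jmat (2 * m) = Jmat (2 * m) * M.map (starRingEnd ℂ) →
        (K * M * K⁻¹) * Jmat (2 * m)
          = Jmat (2 * m) * (K * M * K⁻¹).map (starRingEnd ℂ)) :
    K.det = 1 := by
  have hKt : Kᵀ * K = 1 := hK
  rw [Matrix.inv_eq_left_inv hKt] at hstab
  have hJJ := Jmat_mul_self (2 * m)
  have hJt := Jmat_transpose (2 * m)
  generalize hJ : Jmat (2 * m) = J at *
  obtain ⟨L, hL⟩ : ∃ L, K.map (starRingEnd ℂ) = L := ⟨_, rfl⟩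
  have hLt : Lᵀ * L = 1 := by
    rw [← hL, ← transpose_map, ← Matrix.map_mul, hKt]
    simp [Matrix.map_one]
  obtain ⟨N, hN⟩ : ∃ N, N = -(J * L * J) := ⟨_, rfl⟩
  have hNt : Nᵀ = -(J * Lᵀ * J) := by
    simp [hN, transpose_mul, hJt, mul_assoc]
  have hNN : Nᵀ * N = 1 := by
    rw [hNt, hN]
    calc -(J * Lᵀ * J) * -(J * L * J) = J * Lᵀ * (J * J) * L * J := by noncomm_ring
      _ = -(J * (Lᵀ * L) * J) := by rw [hJJ]; noncomm_ring
      _ = 1 := by rw [hLt, mul_one, hJJ, neg_neg]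
  have hNN' : N * Nᵀ = 1 := mul_eq_one_comm.1 hNN
  obtain ⟨p, hp⟩ : ∃ p : ℂ, Nᵀ * K =
      p • (1 : Matrix (Fin (2 * m) ⊕ Fin (2 * m)) (Fin (2 * m) ⊕ Fin (2 * m)) ℂ) := by
    refine exists_eq_smul_one_of_commute_quaternionic_orthogonal fun M hM hMJ => ?_
    obtain ⟨r, hr, hdet⟩ := det_nonneg_of_mul_Jmat hMJ
    rw [hJ] at hMJ
    have hE := hstab M hM (hM.det_eq_one hr hdet) hMJ
    have hMc : M.map (starRingEnd ℂ) = -(J * M * J) := by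
      rw [mul_assoc, hMJ, ← mul_assoc, hJJ, neg_mul, one_mul, neg_neg]
    rw [Matrix.map_mul, Matrix.map_mul, transpose_map, hL, hMc] at hE
    have hKN : K * M * Kᵀ = N * M * Nᵀ := by
      calc K * M * Kᵀ = -(K * M * Kᵀ * (J * J)) := by rw [hJJ]; noncomm_ring
        _ = -(K * M * Kᵀ * J * J) := by rw [mul_assoc _ J J]
        _ = N * M * Nᵀ := by rw [hE, hNt, hN]; noncomm_ring
    calc Nᵀ * K * M = Nᵀ * (K * M * Kᵀ) * K := by
          rw [mul_assoc _ _ K, mul_assoc _ _ K, hKt, mul_one, mul_assoc]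
      _ = (Nᵀ * N) * M * (Nᵀ * K) := by rw [hKN]; simp only [mul_assoc]
      _ = M * (Nᵀ * K) := by rw [hNN, one_mul]
  have hKN : K = p • N := by
    rw [← one_mul K, ← hNN', mul_assoc, hp, mul_smul_comm, mul_one]
  have hNJ : N * J = J * L := by
    rw [hN, neg_mul, mul_assoc, hJJ, mul_neg, mul_one, neg_neg]
  have hpp : p * p = 1 := by
    have h1 := hKt
    rw [hKN, transpose_smul, smul_mul_smul_comm, hNN] at h1
    have h2 := congrFun (congrFun h1 (Sum.inl ⟨0, by omega⟩)) (Sum.inl ⟨0, by omega⟩)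
    simpa using h2
  rcases mul_self_eq_one_iff.1 hpp with rfl | rfl
  · obtain ⟨r, hr, hdet⟩ := det_nonneg_of_mul_Jmat (X := K)
      (by rw [hJ, hL, ← hNJ, ← one_smul ℂ N, ← hKN])
    exact hK.det_eq_one hr hdet
  · obtain ⟨r, hr, hdet⟩ := det_nonneg_of_mul_Jmat (X := Complex.I • K) (by
      have h1 : (Complex.I • K).map (starRingEnd ℂ) = -(Complex.I • L) := by
        ext a b
        simp [← hL]
      rw [hJ, h1, mul_neg, mul_smul_comm, ← hNJ, smul_mul_assoc, hKN]
      simp)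
    have h4 : (Complex.I • K).det = K.det := by
      rw [det_smul, Fintype.card_sum, Fintype.card_fin,
        show 2 * m + 2 * m = 4 * m by ring, pow_mul, Complex.I_pow_four, one_pow, one_mul]
    exact hK.det_eq_one hr (h4 ▸ hdet)
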